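/- CBV Simulation: for all terms t, u of Plotkin's CBV λ-calculus, if t →_v* u (reflexive-transitive closure of CBV reduction), then t* →_H* u* in the λ_c-calculus, where (·)* is the CBV translation into the λ_c-calculus. -/

import Mathlib

set_option maxHeartbeats 800000

namespace LamC

/-- Patterns of the λ_c-calculus. Variables and tags are natural numbers. -/
inductive Pat : Type where
  | var : ℕ → Pat
  | con : ℕ → List Pat → Pat

mutual
/-- The list of variables of a pattern. -/
def Pat.varList : Pat → List ℕ
  | .var x => [x]
  | .con _ ps => patsVarList ps
/-- The list of variables of a tuple of patterns. -/
def patsVarList : List Pat → List ℕ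
  | [] => []
  | p :: ps => p.varList ++ patsVarList ps
end

/-- The set of variables of a pattern. -/
def Pat.vars (p : Pat) : Finset ℕ := p.varList.toFinset

/-- Linearity of a pattern: every variable occurs at most once. -/
def Pat.Linear (p : Pat) : Prop := p.varList.Nodup

/-- Terms of the λ_c-calculus: variables, generalized abstractions, applications,
matching closures `t[p\u]`, tagged products (data terms) and case expressions.
A branch is a tag together with a tuple of patterns (the data pattern) and a body. -/
inductive Tm : Type where
  | var : ℕ → Tm
  | lam : Pat → Tm → Tm
  | app : Tm → Tm → Tm
  | mat : Tm → Pat → Tm → Tm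
  | con : ℕ → List Tm → Tm
  | case : Tm → List (ℕ × List Pat × Tm) → Tm

/-- Branches of case expressions. -/
abbrev Br := ℕ × List Pat × Tm

mutual
/-- Free variables of a term. -/
def Tm.fv : Tm → Finset ℕ
  | .var x => {x}
  | .lam p t => Tm.fv t \ p.vars
  | .app t u => Tm.fv t ∪ Tm.fv u
  | .mat t p u => (Tm.fv t \ p.vars) ∪ Tm.fv u
  | .con _ ts => fvList ts
  | .case t bs => Tm.fv t ∪ fvBrs bs
def fvList : List Tm → Finset ℕ
  | [] => ∅
  | t :: ts => Tm.fv t ∪ fvList ts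
def fvBrs : List Br → Finset ℕ
  | [] => ∅
  | (_, ps, u) :: bs => (Tm.fv u \ (patsVarList ps).toFinset) ∪ fvBrs bs
end

mutual
/-- Substitution `t{x:=u}` (binder-aware, terms being identified up to α-equivalence). -/
def Tm.subst : Tm → ℕ → Tm → Tm
  | .var y, x, u => if y = x then u else .var y
  | .lam p t, x, u => if x ∈ p.vars then .lam p t else .lam p (Tm.subst t x u)
  | .app t s, x, u => .app (Tm.subst t x u) (Tm.subst s x u)
  | .mat t p s, x, u => .mat (if x ∈ p.vars then t else Tm.subst t x u) p (Tm.subst s x u)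
  | .con c ts, x, u => .con c (substList ts x u)
  | .case t bs, x, u => .case (Tm.subst t x u) (substBrs bs x u)
def substList : List Tm → ℕ → Tm → List Tm
  | [], _, _ => []
  | t :: ts, x, u => Tm.subst t x u :: substList ts x u
def substBrs : List Br → ℕ → Tm → List Br
  | [], _, _ => []
  | (c, ps, t) :: bs, x, u =>
      (c, ps, if x ∈ (patsVarList ps).toFinset then t else Tm.subst t x u) :: substBrs bs x u
end

/-- List contexts `L ::= □ | L[p\u]`, represented as the list of explicit matchings,
from the innermost (closest to the hole) to the outermost. -/
abbrev LCtx := List (Pat × Tm)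

/-- Bound variables of a list context. -/
def LCtx.bv (L : LCtx) : Finset ℕ := L.foldr (fun pu s => pu.1.vars ∪ s) ∅

/-- Plugging a term into a list context. -/
def LCtx.plug (L : LCtx) (t : Tm) : Tm := L.foldl (fun s pu => .mat s pu.1 pu.2) t

/-- `matSeq t ps us` is `t[p₁\u₁]…[pₙ\uₙ]`. -/
def matSeq (t : Tm) (ps : List Pat) (us : List Tm) : Tm :=
  (List.zip ps us).foldl (fun s pu => .mat s pu.1 pu.2) t

/-- Well-formed terms of the λ_c-calculus: patterns are linear (tuples of patterns jointly so)
and the top-level tags of the branches of every case expression are pairwise distinct. -/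
inductive Wf : Tm → Prop where
  | var : ∀ x, Wf (.var x)
  | lam : ∀ p t, p.Linear → Wf t → Wf (.lam p t)
  | app : ∀ t u, Wf t → Wf u → Wf (.app t u)
  | mat : ∀ t p u, p.Linear → Wf t → Wf u → Wf (.mat t p u)
  | con : ∀ c ts, (∀ t ∈ ts, Wf t) → Wf (.con c ts)
  | case : ∀ t (bs : List Br), Wf t → (bs.map (·.1)).Nodup →
      (∀ b ∈ bs, (patsVarList b.2.1).Nodup) → (∀ b ∈ bs, Wf b.2.2) → Wf (.case t bs)

/-- The weak head reduction relation `→_H`. -/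
inductive StepH : Tm → Tm → Prop where
  | beta : ∀ (L : LCtx) p t u, Disjoint L.bv u.fv →
      StepH (.app (L.plug (.lam p t)) u) (L.plug (.mat t p u))
  | caseC : ∀ (L : LCtx) (c : ℕ) (us : List Tm) (ps : List Pat) (t : Tm) (bs₁ bs₂ : List Br),
      ps.length = us.length → Disjoint L.bv t.fv →
      StepH (.case (L.plug (.con c us)) (bs₁ ++ (c, ps, t) :: bs₂)) (L.plug (matSeq t ps us))
  | matM : ∀ (L : LCtx) (c : ℕ) (ps : List Pat) (us : List Tm) (t : Tm),
      ps.length = us.length → Disjoint L.bv t.fv →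
      StepH (.mat t (.con c ps) (L.plug (.con c us))) (L.plug (matSeq t ps us))
  | matE : ∀ t x u, StepH (.mat t (.var x) u) (Tm.subst t x u)
  | appH : ∀ t t' u, StepH t t' → StepH (.app t u) (.app t' u)
  | matHL : ∀ t t' p u, StepH t t' → StepH (.mat t p u) (.mat t' p u)
  | matHR : ∀ t c ps u u', StepH u u' → StepH (.mat t (.con c ps) u) (.mat t (.con c ps) u')
  | caseH : ∀ t t' bs, StepH t t' → StepH (.case t bs) (.case t' bs)

end LamC

namespace LamC

/-- `abs(t)`: `t = L⟨λp.u⟩` for some list context `L`. -/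
def IsAbs (t : Tm) : Prop := ∃ (L : LCtx) (p : Pat) (u : Tm), t = L.plug (.lam p u)

/-- `data_c(t)`: `t = L⟨c(u₁,…,uₙ)⟩` for some list context `L`. -/
def IsData (c : ℕ) (t : Tm) : Prop := ∃ (L : LCtx) (us : List Tm), t = L.plug (.con c us)

/-- `Red t` holds iff `t` is reducible for the weak head evaluation strategy `↝`
(this is definitionally unfolded so that it can be used in the rule (esR) below). -/
def Red : Tm → Prop
  | .var _ => False
  | .lam _ _ => False
  | .con _ _ => False
  | .app t u =>
      (∃ (L : LCtx) (p : Pat) (b : Tm), t = L.plug (.lam p b) ∧ Disjoint L.bv u.fv)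
      ∨ (¬ IsAbs t ∧ Red t)
  | .mat _ (.var _) _ => True
  | .mat t (.con c ps) u =>
      (∃ (L : LCtx) (us : List Tm), u = L.plug (.con c us) ∧ ps.length = us.length
          ∧ Disjoint L.bv t.fv)
      ∨ (¬ IsData c u ∧ (Red t ∨ (¬ Red t ∧ Red u)))
  | .case t bs =>
      (∃ (L : LCtx) (c : ℕ) (us : List Tm) (ps : List Pat) (b : Tm) (bs₁ bs₂ : List Br),
          t = L.plug (.con c us) ∧ bs = bs₁ ++ (c, ps, b) :: bs₂ ∧ ps.length = us.length
          ∧ Disjoint L.bv b.fv)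
      ∨ ((∀ br ∈ bs, ¬ IsData br.1 t) ∧ Red t)

/-- The weak head evaluation strategy `↝`. -/
inductive StepE : Tm → Tm → Prop where
  | beta : ∀ (L : LCtx) p t u, Disjoint L.bv u.fv →
      StepE (.app (L.plug (.lam p t)) u) (L.plug (.mat t p u))
  | appL : ∀ t t' u, ¬ IsAbs t → StepE t t' → StepE (.app t u) (.app t' u)
  | matM : ∀ (L : LCtx) (c : ℕ) (ps : List Pat) (us : List Tm) (t : Tm),
      ps.length = us.length → Disjoint L.bv t.fv →
      StepE (.mat t (.con c ps) (L.plug (.con c us))) (L.plug (matSeq t ps us))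
  | matE : ∀ t x u, StepE (.mat t (.var x) u) (Tm.subst t x u)
  | esL : ∀ t t' c ps u, ¬ IsData c u → StepE t t' →
      StepE (.mat t (.con c ps) u) (.mat t' (.con c ps) u)
  | esR : ∀ t c ps u u', ¬ IsData c u → ¬ Red t → StepE u u' →
      StepE (.mat t (.con c ps) u) (.mat t (.con c ps) u')
  | caseC : ∀ (L : LCtx) (c : ℕ) (us : List Tm) (ps : List Pat) (t : Tm) (bs₁ bs₂ : List Br),
      ps.length = us.length → Disjoint L.bv t.fv →
      StepE (.case (L.plug (.con c us)) (bs₁ ++ (c, ps, t) :: bs₂)) (L.plug (matSeq t ps us))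
  | caseIn : ∀ t t' (bs : List Br), (∀ b ∈ bs, ¬ IsData b.1 t) → StepE t t' →
      StepE (.case t bs) (.case t' bs)

/-- `n`-step weak head reduction `→_H`. -/
inductive StepsH : ℕ → Tm → Tm → Prop where
  | refl : ∀ t, StepsH 0 t t
  | step : ∀ {n t u r}, StepH t u → StepsH n u r → StepsH (n + 1) t r

/-- `n`-step weak head evaluation `↝`. -/
inductive StepsE : ℕ → Tm → Tm → Prop where
  | refl : ∀ t, StepsE 0 t t
  | step : ∀ {n t u r}, StepE t u → StepsE n u r → StepsE (n + 1) t r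

mutual
/-- Neutral forms `ne`. -/
inductive Ne : Tm → Prop where
  | var : ∀ x, Ne (.var x)
  | app : ∀ (c : ℕ) t u, Na c t → Ne (.app t u)
  | mat : ∀ t (c' : ℕ) ps (c'' : ℕ) u, Ne t → No c'' u → c'' ≠ c' →
      Ne (.mat t (.con c' ps) u)
  | case : ∀ (c' : ℕ) t (bs : List Br), No c' t → c' ∉ bs.map (·.1) → Ne (.case t bs)
/-- Neutral data forms `na_c`. -/
inductive Na : ℕ → Tm → Prop where
  | ne : ∀ c t, Ne t → Na c t
  | con : ∀ c ts, Na c (.con c ts)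
  | mat : ∀ c t (c' : ℕ) ps (c'' : ℕ) u, Na c t → No c'' u → c'' ≠ c' →
      Na c (.mat t (.con c' ps) u)
/-- Normal forms `no_c` with respect to a tag `c`. -/
inductive No : ℕ → Tm → Prop where
  | na : ∀ c t, Na c t → No c t
  | lam : ∀ c p t, No c (.lam p t)
  | mat : ∀ c t (c' : ℕ) ps (c'' : ℕ) u, No c t → No c'' u → c'' ≠ c' →
      No c (.mat t (.con c' ps) u)
end

/-- The set `no` of normal forms: `no = ⋃_c no_c`. -/
def NormalForm (t : Tm) : Prop := ∃ c : ℕ, No c t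

/-- Base clashes. -/
inductive BCl : Tm → Prop where
  | appCon : ∀ (L : LCtx) (c : ℕ) ts u, BCl (.app (L.plug (.con c ts)) u)
  | matLam : ∀ t (c : ℕ) ps (L : LCtx) q u, BCl (.mat t (.con c ps) (L.plug (.lam q u)))
  | matCon : ∀ t (c : ℕ) ps (L : LCtx) (c' : ℕ) ts, c ≠ c' →
      BCl (.mat t (.con c ps) (L.plug (.con c' ts)))
  | caseLam : ∀ (L : LCtx) p t (bs : List Br), BCl (.case (L.plug (.lam p t)) bs)
  | caseCon : ∀ (L : LCtx) (c : ℕ) ts (bs : List Br), c ∉ bs.map (·.1) →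
      BCl (.case (L.plug (.con c ts)) bs)

/-- Clashes. -/
inductive Cl : Tm → Prop where
  | base : ∀ t, BCl t → Cl t
  | app : ∀ t u, Cl t → Cl (.app t u)
  | matL : ∀ t p u, Cl t → Cl (.mat t p u)
  | matR : ∀ t p u, Cl u → Cl (.mat t p u)
  | case : ∀ t (bs : List Br), Cl t → Cl (.case t bs)

mutual
/-- Clash-free neutral forms `ncf`. -/
inductive Ncf : Tm → Prop where
  | var : ∀ x, Ncf (.var x)
  | app : ∀ t u, Ncf t → Ncf (.app t u)
  | mat : ∀ t (c : ℕ) ps u, Ncf t → Ncf u → Ncf (.mat t (.con c ps) u)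
  | case : ∀ t (bs : List Br), Ncf t → Ncf (.case t bs)
/-- Clash-free normal forms `cf`. -/
inductive Cf : Tm → Prop where
  | ncf : ∀ t, Ncf t → Cf t
  | lam : ∀ p t, Cf (.lam p t)
  | con : ∀ (c : ℕ) ts, Cf (.con c ts)
  | mat : ∀ t (c : ℕ) ps u, Cf t → Ncf u → Cf (.mat t (.con c ps) u)
end

end LamC

namespace LamC

/-! ### Plotkin's CBN λ-calculus (as a subset of the λ_c-calculus) -/

/-- Terms of Plotkin's CBN λ-calculus, viewed as λ_c-terms via the identity inclusion. -/
inductive IsCBN : Tm → Prop where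
  | var : ∀ x, IsCBN (.var x)
  | lam : ∀ x t, IsCBN t → IsCBN (.lam (.var x) t)
  | app : ∀ t u, IsCBN t → IsCBN u → IsCBN (.app t u)

/-- The CBN reduction `→_n`. -/
inductive StepN : Tm → Tm → Prop where
  | beta : ∀ x t u, StepN (.app (.lam (.var x) t) u) (Tm.subst t x u)
  | appL : ∀ t t' u, StepN t t' → StepN (.app t u) (.app t' u)

/-! ### Plotkin's CBV λ-calculus -/

/-- Terms of Plotkin's CBV λ-calculus. -/
inductive VTm : Type where
  | var : ℕ → VTm
  | lam : ℕ → VTm → VTm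
  | app : VTm → VTm → VTm

/-- Values of the CBV λ-calculus. -/
def VTm.IsVal : VTm → Prop
  | .var _ => True
  | .lam _ _ => True
  | .app _ _ => False

/-- Substitution in the CBV λ-calculus. -/
def VTm.subst : VTm → ℕ → VTm → VTm
  | .var y, x, v => if y = x then v else .var y
  | .lam y t, x, v => if y = x then .lam y t else .lam y (VTm.subst t x v)
  | .app t u, x, v => .app (VTm.subst t x v) (VTm.subst u x v)

/-- The CBV reduction `→_v` (closure of `β_v` under CBV contexts `V ::= □ | V t | v V`). -/
inductive StepV : VTm → VTm → Prop where
  | beta : ∀ x t v, VTm.IsVal v → StepV (.app (.lam x t) v) (VTm.subst t x v)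
  | appL : ∀ t t' u, StepV t t' → StepV (.app t u) (.app t' u)
  | appR : ∀ v u u', VTm.IsVal v → StepV u u' → StepV (.app v u) (.app v u')

/-- The tag `𝚟` used to tag CBV values. -/
def vtag : ℕ := 0

/-- The CBV translation `(·)* : Λ_v → Λ_c`.  CBV variables are embedded as even
variables of the λ_c-calculus, so that the odd variables `1` and `3` are fresh:
`(t u)* = (x y)[𝚟(y)\u*][𝚟(x)\t*]` with `x = 1`, `y = 3`, and `v* = 𝚟(v°)` on values. -/
def trCBV : VTm → Tm
  | .var n => .con vtag [.var (2 * n)]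
  | .lam x t => .con vtag [.lam (.var (2 * x)) (trCBV t)]
  | .app t u =>
      .mat (.mat (.app (.var 1) (.var 3)) (.con vtag [.var 3]) (trCBV u))
        (.con vtag [.var 1]) (trCBV t)

/-! ### The bang-calculus λ^! -/

/-- Terms of the bang-calculus. -/
inductive BTm : Type where
  | var : ℕ → BTm
  | lam : ℕ → BTm → BTm
  | app : BTm → BTm → BTm
  | bang : BTm → BTm
  | mat : BTm → ℕ → BTm → BTm

/-- Free variables of a bang-calculus term. -/
def BTm.fv : BTm → Finset ℕ
  | .var x => {x}
  | .lam x t => BTm.fv t \ {x}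
  | .app t u => BTm.fv t ∪ BTm.fv u
  | .bang t => BTm.fv t
  | .mat t x u => (BTm.fv t \ {x}) ∪ BTm.fv u

/-- Substitution in the bang-calculus. -/
def BTm.subst : BTm → ℕ → BTm → BTm
  | .var y, x, u => if y = x then u else .var y
  | .lam y t, x, u => if y = x then .lam y t else .lam y (BTm.subst t x u)
  | .app t s, x, u => .app (BTm.subst t x u) (BTm.subst s x u)
  | .bang t, x, u => .bang (BTm.subst t x u)
  | .mat t y s, x, u => .mat (if y = x then t else BTm.subst t x u) y (BTm.subst s x u)

/-- Bang list contexts `Λ ::= □ | Λ[x\t]`, innermost first. -/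
abbrev BLCtx := List (ℕ × BTm)

/-- Bound variables of a bang list context. -/
def BLCtx.bv (L : BLCtx) : Finset ℕ := L.foldr (fun a s => {a.1} ∪ s) ∅

/-- Plugging a bang-calculus term into a bang list context. -/
def BLCtx.plug (L : BLCtx) (t : BTm) : BTm := L.foldl (fun s a => .mat s a.1 a.2) t

/-- The bang reduction `→_!` (closure of (dB) and (s) under weak head surface contexts
`W ::= □ | W t | W[x\u] | t[x\W]`). -/
inductive StepB : BTm → BTm → Prop where
  | dB : ∀ (L : BLCtx) (x : ℕ) (t u : BTm), Disjoint L.bv u.fv →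
      StepB (.app (L.plug (.lam x t)) u) (L.plug (.mat t x u))
  | s : ∀ (L : BLCtx) (x : ℕ) (t u : BTm), Disjoint L.bv t.fv →
      StepB (.mat t x (L.plug (.bang u))) (L.plug (BTm.subst t x u))
  | appL : ∀ t t' u, StepB t t' → StepB (.app t u) (.app t' u)
  | matL : ∀ t t' x u, StepB t t' → StepB (.mat t x u) (.mat t' x u)
  | matR : ∀ t x u u', StepB u u' → StepB (.mat t x u) (.mat t x u')

/-- The tag `𝚋` used to tag banged terms. -/
def btag : ℕ := 0

/-- The bang translation `(·)^♭ : Λ^! → Λ_c`. -/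
def trBang : BTm → Tm
  | .var x => .var x
  | .lam x t => .lam (.con btag [.var x]) (trBang t)
  | .app t u => .app (trBang t) (trBang u)
  | .bang t => .con btag [trBang t]
  | .mat t x u => .mat (trBang t) (.con btag [.var x]) (trBang u)

end LamC

namespace LamC

/-! ### Non-idempotent intersection types and the type system 𝒫 -/

/-- Term types `σ ::= A | ★ | M → σ`, where multiset types are represented by lists
(whose coercion to `Multiset` gives the multiset semantics), and data types are
`c(M₁,…,Mₙ)`. -/
inductive Ty : Type where
  | star : Ty
  | arrow : List Ty → Ty → Ty
  | data : ℕ → List (List Ty) → Ty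

/-- Typing contexts: finitely supported functions from variables to multiset types. -/
abbrev TCtx := ℕ →₀ Multiset Ty

/-- Restriction `Γ|_X` of a typing context to a set of variables. -/
def TCtx.restrict (Γ : TCtx) (X : Finset ℕ) : TCtx := Γ.filter (· ∈ X)

/-- `Γ∖∖X`: the typing context `Γ` set to the empty multiset on `X`. -/
def TCtx.erase (Γ : TCtx) (X : Finset ℕ) : TCtx := Γ.filter (· ∉ X)

mutual
/-- Pattern typing `Γ ⊩ p : M`. -/
inductive PJ : TCtx → Pat → Multiset Ty → Type where
  | pvar : ∀ (x : ℕ) (M : Multiset Ty), PJ (Finsupp.single x M) (.var x) M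
  | pcon : ∀ (c : ℕ) {Γ : TCtx} {ps : List Pat} {Ms : List (List Ty)},
      PCJ Γ ps Ms → PJ Γ (.con c ps) {Ty.data c Ms}
/-- Pointwise pattern typing of tuples of patterns. -/
inductive PCJ : TCtx → List Pat → List (List Ty) → Type where
  | nil : PCJ 0 [] []
  | cons : ∀ {Γ Δ : TCtx} {p : Pat} {ps : List Pat} {M : List Ty} {Ms : List (List Ty)},
      PJ Γ p ↑M → PCJ Δ ps Ms → PCJ (Γ + Δ) (p :: ps) (M :: Ms)
end

mutual
/-- Term typing `Γ ⊢ t : σ` in system 𝒫. -/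
inductive TJ : TCtx → Tm → Ty → Type where
  | ax : ∀ (x : ℕ) (σ : Ty), TJ (Finsupp.single x {σ}) (.var x) σ
  | abs : ∀ {Γ : TCtx} {t : Tm} {σ : Ty} (p : Pat) {M : List Ty},
      TJ Γ t σ → PJ (Γ.restrict p.vars) p ↑M →
      TJ (Γ.erase p.vars) (.lam p t) (.arrow M σ)
  | absStar : ∀ (p : Pat) (t : Tm), TJ 0 (.lam p t) .star
  | app : ∀ {Γ Δ : TCtx} {t u : Tm} {M : List Ty} {σ : Ty},
      TJ Γ t (.arrow M σ) → MJ Δ u ↑M → TJ (Γ + Δ) (.app t u) σ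
  | const : ∀ (c : ℕ) {Γ : TCtx} {ts : List Tm} {Ms : List (List Ty)},
      CJ Γ ts Ms → TJ Γ (.con c ts) (.data c Ms)
  | matc : ∀ {Γ Δ : TCtx} {t u : Tm} {σ : Ty} {M : Multiset Ty} (p : Pat),
      TJ Γ t σ → PJ (Γ.restrict p.vars) p M → MJ Δ u M →
      TJ (Γ.erase p.vars + Δ) (.mat t p u) σ
  | cse : ∀ {Γ Δ : TCtx} {t : Tm} {M : Multiset Ty} {σ : Ty}
      (bs₁ bs₂ : List Br) (c : ℕ) (ps : List Pat) (uk : Tm),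
      MJ Δ t M → PJ (Γ.restrict (Pat.con c ps).vars) (.con c ps) M → TJ Γ uk σ →
      TJ (Γ.erase (Pat.con c ps).vars + Δ) (.case t (bs₁ ++ (c, ps, uk) :: bs₂)) σ
/-- Multiset typing `Γ ⊢ t : M` (rule (many), presented element by element). -/
inductive MJ : TCtx → Tm → Multiset Ty → Type where
  | nil : ∀ (t : Tm), MJ 0 t 0
  | cons : ∀ {Γ Δ : TCtx} {t : Tm} {σ : Ty} {M : Multiset Ty},
      TJ Γ t σ → MJ Δ t M → MJ (Γ + Δ) t (σ ::ₘ M)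
/-- Pointwise multiset typing of tuples of terms (premises of rule (const)). -/
inductive CJ : TCtx → List Tm → List (List Ty) → Type where
  | nil : CJ 0 [] []
  | cons : ∀ {Γ Δ : TCtx} {t : Tm} {ts : List Tm} {M : List Ty} {Ms : List (List Ty)},
      MJ Γ t ↑M → CJ Δ ts Ms → CJ (Γ + Δ) (t :: ts) (M :: Ms)
end

mutual
/-- Size of a pattern typing derivation. -/
def PJ.size : ∀ {Γ p M}, PJ Γ p M → ℕ
  | _, _, _, .pvar _ _ => 1
  | _, _, _, .pcon _ d => 1 + PCJ.size d
def PCJ.size : ∀ {Γ ps Ms}, PCJ Γ ps Ms → ℕ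
  | _, _, _, .nil => 0
  | _, _, _, .cons d ds => PJ.size d + PCJ.size ds
end

mutual
/-- Size of a term typing derivation: the number of rule occurrences, not counting
occurrences of the rules (many) and (match). -/
def TJ.size : ∀ {Γ t σ}, TJ Γ t σ → ℕ
  | _, _, _, .ax _ _ => 1
  | _, _, _, .abs _ d pd => 1 + TJ.size d + PJ.size pd
  | _, _, _, .absStar _ _ => 1
  | _, _, _, .app d m => 1 + TJ.size d + MJ.size m
  | _, _, _, .const _ cj => 1 + CJ.size cj
  | _, _, _, .matc _ d pd m => TJ.size d + PJ.size pd + MJ.size m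
  | _, _, _, .cse _ _ _ _ _ m pd d => 1 + MJ.size m + PJ.size pd + TJ.size d
def MJ.size : ∀ {Γ t M}, MJ Γ t M → ℕ
  | _, _, _, .nil _ => 0
  | _, _, _, .cons d m => TJ.size d + MJ.size m
def CJ.size : ∀ {Γ ts Ms}, CJ Γ ts Ms → ℕ
  | _, _, _, .nil => 0
  | _, _, _, .cons m cj => MJ.size m + CJ.size cj
end

end LamC


namespace LamC

/-- Odd variables do not occur free in a CBV translation. -/
theorem subst_trCBV_of_odd (t : VTm) {k : ℕ} (hk : Odd k) (w : Tm) :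
    Tm.subst (trCBV t) k w = trCBV t := by
  induction t with
  | var n =>
    have h : 2 * n ≠ k := by rintro rfl; exact Nat.not_odd_iff_even.2 (even_two_mul n) hk
    simp [trCBV, Tm.subst, substList, h]
  | lam x t ih => simp [trCBV, Tm.subst, substList, ih]
  | app t u iht ihu =>
    simp only [trCBV, Tm.subst, iht, ihu, Pat.vars, Pat.varList, patsVarList]
    split_ifs <;> simp_all [@eq_comm ℕ _ k]

theorem VTm.IsVal.trCBV_eq {v : VTm} (hv : v.IsVal) : ∃ w, trCBV v = .con vtag [w] := by
  cases v with
  | var n => exact ⟨_, rfl⟩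
  | lam x t => exact ⟨_, rfl⟩
  | app t u => exact hv.elim

/-- The CBV translation commutes with the substitution of values. -/
theorem trCBV_subst (t : VTm) (x : ℕ) {v : VTm} {w : Tm} (hw : trCBV v = .con vtag [w]) :
    trCBV (VTm.subst t x v) = Tm.subst (trCBV t) (2 * x) w := by
  induction t with
  | var n => by_cases h : n = x <;> simp [VTm.subst, trCBV, Tm.subst, substList, h, hw]
  | lam y t ih =>
    by_cases h : y = x
    · simp [VTm.subst, trCBV, Tm.subst, substList, Pat.vars, Pat.varList, h]
    · simp [VTm.subst, trCBV, Tm.subst, substList, Pat.vars, Pat.varList, h, Ne.symm h, ih]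
  | app t u iht ihu =>
    have h₁ : 2 * x ≠ 1 := by omega
    have h₃ : 2 * x ≠ 3 := by omega
    simp [VTm.subst, trCBV, Tm.subst, Pat.vars, Pat.varList, patsVarList, iht, ihu,
      h₁, h₃, h₁.symm, h₃.symm]

/-- Matching a unary tagged term against a unary data pattern with a variable argument. -/
theorem reflTransGen_stepH_mat_con_var (t : Tm) (c x : ℕ) (u : Tm) :
    Relation.ReflTransGen StepH (.mat t (.con c [.var x]) (.con c [u])) (Tm.subst t x u) :=
  (Relation.ReflTransGen.single (StepH.matM [] c [.var x] [u] t rfl (by simp [LCtx.bv]))).tail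
    (StepH.matE t x u)

/-- A CBV step is simulated by weak head reduction through the translation. -/
theorem StepV.trCBV {t u : VTm} (h : StepV t u) :
    Relation.ReflTransGen StepH (trCBV t) (trCBV u) := by
  induction h with
  | beta x t v hv =>
    obtain ⟨w, hw⟩ := hv.trCBV_eq
    have hv₁ : Tm.subst (.con vtag [w]) 1 (.lam (.var (2 * x)) (LamC.trCBV t)) =
        .con vtag [w] := hw ▸ subst_trCBV_of_odd v (by decide) _
    have ht₃ : Tm.subst (LamC.trCBV t) 3 w = LamC.trCBV t :=
      subst_trCBV_of_odd t (by decide) w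
    rw [trCBV_subst t x hw]
    simp only [LamC.trCBV, hw]
    refine (reflTransGen_stepH_mat_con_var _ _ _ _).trans ?_
    rw [Tm.subst, hv₁]
    simp only [Tm.subst, Pat.vars, Pat.varList, patsVarList]
    refine (reflTransGen_stepH_mat_con_var _ _ _ _).trans ?_
    simp only [List.append_nil, List.toFinset_cons, List.toFinset_nil, insert_empty_eq,
      Finset.mem_singleton, OfNat.one_ne_ofNat, OfNat.ofNat_ne_one, if_false, if_true, Tm.subst,
      ht₃, ite_self, Pat.vars, Pat.varList]
    exact (Relation.ReflTransGen.single
      (StepH.beta [] (.var (2 * x)) (LamC.trCBV t) w (by simp [LCtx.bv]))).tail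
        (StepH.matE _ _ _)
  | appL t t' u _ ih => exact ih.lift (Tm.mat _ _) fun _ _ => StepH.matHR _ _ _ _ _
  | appR v u u' _ _ ih =>
    exact ih.lift (fun s => Tm.mat (.mat _ _ s) _ _)
      fun _ _ hs => StepH.matHL _ _ _ _ (StepH.matHR _ _ _ _ _ hs)

theorem cbv_simulation (t u : VTm) (h : Relation.ReflTransGen StepV t u) :
    Relation.ReflTransGen StepH (trCBV t) (trCBV u) :=
  h.lift' trCBV fun _ _ hs => hs.trCBV

end LamC
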